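/- arXiv:0809.0119 — 5 statements merged into one kernel-verified Lean document; each statement's English description precedes it below -/
import Mathlib

section
/- Let p ≥ 5 be a prime of the form p = 12l − 5 for a positive integer l. Then N(p, (−1, 1, 2)) = l − 1. -/
/-- `Nweight p a₀ a₁ a₂` is the number `N(p, α)` for `α = (a₀, a₁, a₂)`: the number of
ordered triples `(n₀, n₁, n₂)` of nonnegative integers with `n₀ + n₁ + n₂ = (p - 3)/2` and
`a₀·n₀ + a₁·n₁ + a₂·n₂ + (a₀ + a₁ + a₂)/2 ≡ 0 (mod p)`. -/
noncomputable def Nweight (p : ℕ) (a₀ a₁ a₂ : ℤ) : ℕ :=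
  Nat.card {n : ℕ × ℕ × ℕ //
    n.1 + n.2.1 + n.2.2 = (p - 3) / 2 ∧
    (p : ℤ) ∣ a₀ * n.1 + a₁ * n.2.1 + a₂ * n.2.2 + (a₀ + a₁ + a₂) / 2}

/-- If `p ≥ 5` is a prime of the form `p = 12l - 5` with `l` a positive integer,
then `N(p, (-1, 1, 2)) = l - 1`. -/
theorem stmt_4 (p l : ℕ) (hp : p.Prime) (hp5 : 5 ≤ p) (hl : 0 < l) (hpl : p = 12 * l - 5) :
    Nweight p (-1) 1 2 = l - 1 := by
  subst hpl
  have key : ∀ n : ℕ × ℕ × ℕ,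
      (n.1 + n.2.1 + n.2.2 = (12 * l - 5 - 3) / 2 ∧
        ((12 * l - 5 : ℕ) : ℤ) ∣ (-1) * n.1 + 1 * n.2.1 + 2 * n.2.2 + (-1 + 1 + 2) / 2) ↔
      (n.1 = n.2.1 + 2 * n.2.2 + 1 ∧ 2 * n.2.1 + 3 * n.2.2 + 5 = 6 * l) := by
    rintro ⟨a, b, c⟩
    dsimp only
    norm_num
    constructor
    · rintro ⟨h, hd⟩
      have h0 : -(a : ℤ) + b + 2 * c + 1 = 0 := by
        refine Int.eq_zero_of_abs_lt_dvd hd ?_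
        rw [abs_lt]
        constructor <;> omega
      omega
    · rintro ⟨h, h'⟩
      refine ⟨by omega, ?_⟩
      have h0 : -(a : ℤ) + b + 2 * c + 1 = 0 := by omega
      rw [h0]
      exact dvd_zero _
  unfold Nweight
  rw [Nat.card_congr (Equiv.subtypeEquivRight key)]
  let e : Fin (l - 1) ≃ {n : ℕ × ℕ × ℕ //
      n.1 = n.2.1 + 2 * n.2.2 + 1 ∧ 2 * n.2.1 + 3 * n.2.2 + 5 = 6 * l} :=
    { toFun := fun k => ⟨(3 * l - 1 + k, 3 * l - 4 - 3 * k, 2 * k + 1), by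
        have := k.isLt
        dsimp only
        omega⟩
      invFun := fun n => ⟨n.1.2.2 / 2, by
        have := n.2
        omega⟩
      left_inv := fun k => by
        ext
        dsimp only
        omega
      right_inv := fun ⟨⟨a, b, c⟩, h⟩ => by
        dsimp only at h
        simp only [Subtype.mk.injEq, Prod.mk.injEq]
        omega }
  rw [← Nat.card_congr e, Nat.card_fin]
end

section
/- Let p ≥ 5 be a prime of the form p = 12l − 1 for a positive integer l. Then N(p, (−1, 1, 2)) = l. -/
/-- For `p = 12 l - 1` the counted triples are `(3l + k, 3l - 3k - 3, 2k + 1)` with `k < l`. -/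
theorem weight_condition_iff (l : ℕ) (hl : 0 < l) (n : ℕ × ℕ × ℕ) :
    (n.1 + n.2.1 + n.2.2 = (12 * l - 1 - 3) / 2 ∧
      ((12 * l - 1 : ℕ) : ℤ) ∣ (-1) * n.1 + 1 * n.2.1 + 2 * n.2.2 + (-1 + 1 + 2) / 2) ↔
    ∃ k < l, (3 * l + k, 3 * l - 3 * k - 3, 2 * k + 1) = n := by
  obtain ⟨a, b, c⟩ := n
  simp only [Prod.mk.injEq]
  constructor
  · rintro ⟨hsum, hdvd⟩
    have hzero := Int.eq_zero_of_abs_lt_dvd hdvd (by rw [abs_lt]; omega)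
    exact ⟨a - 3 * l, by omega, by omega, by omega, by omega⟩
  · rintro ⟨k, hk, rfl, rfl, rfl⟩
    refine ⟨by omega, ?_⟩
    have hzero : (-1 : ℤ) * (3 * l + k : ℕ) + 1 * (3 * l - 3 * k - 3 : ℕ) +
        2 * (2 * k + 1 : ℕ) + (-1 + 1 + 2) / 2 = 0 := by omega
    exact hzero ▸ dvd_zero _

/-- If `p ≥ 5` is a prime of the form `p = 12l - 1` with `l` a positive integer,
then `N(p, (-1, 1, 2)) = l`. -/
theorem stmt_5 (p l : ℕ) (hp : p.Prime) (hp5 : 5 ≤ p) (hl : 0 < l) (hpl : p = 12 * l - 1) :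
    Nweight p (-1) 1 2 = l := by
  subst hpl
  unfold Nweight
  simp_rw [weight_condition_iff l hl]
  have hinj : Function.Injective
      fun k : ℕ => ((3 * l + k, 3 * l - 3 * k - 3, 2 * k + 1) : ℕ × ℕ × ℕ) := by
    intro j k hjk
    simp only [Prod.mk.injEq] at hjk
    omega
  calc _ = Nat.card ((fun k : ℕ => ((3 * l + k, 3 * l - 3 * k - 3, 2 * k + 1) : ℕ × ℕ × ℕ)) ''
        Set.Iio l) := rfl
    _ = l := by rw [Nat.card_image_of_injective hinj]; simp
end

section
/- Let p ≥ 5 be a prime of the form p = 12l + 1 for a positive integer l. Then N(p, (−1, 1, 2)) = l. -/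
/-- If `p ≥ 5` is a prime of the form `p = 12l + 1` with `l` a positive integer,
then `N(p, (-1, 1, 2)) = l`. -/
theorem stmt_6 (p l : ℕ) (hp : p.Prime) (hp5 : 5 ≤ p) (hl : 0 < l) (hpl : p = 12 * l + 1) :
    Nweight p (-1) 1 2 = l := by
  have key : ∀ n : ℕ × ℕ × ℕ, (n.1 + n.2.1 + n.2.2 = (p - 3) / 2 ∧
      (p : ℤ) ∣ -1 * n.1 + 1 * n.2.1 + 2 * n.2.2 + (-1 + 1 + 2) / 2) ↔
      n ∈ (Finset.range l).image fun k => (3 * l + k, 3 * l - 1 - 3 * k, 2 * k) := by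
    rintro ⟨a, b, c⟩
    simp only [Finset.mem_image, Finset.mem_range, Prod.mk.injEq]
    constructor
    · rintro ⟨hsum, hdvd⟩
      have hzero := Int.eq_zero_of_abs_lt_dvd hdvd (by rw [abs_lt]; omega)
      exact ⟨c / 2, by omega, by omega, by omega, by omega⟩
    · rintro ⟨k, hk, rfl, rfl, rfl⟩
      refine ⟨by omega, ?_⟩
      have hzero : -1 * ((3 * l + k : ℕ) : ℤ) + 1 * ((3 * l - 1 - 3 * k : ℕ) : ℤ) +
          2 * ((2 * k : ℕ) : ℤ) + (-1 + 1 + 2) / 2 = 0 := by omega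
      exact hzero ▸ dvd_zero (p : ℤ)
  rw [Nweight, Nat.card_congr (Equiv.subtypeEquivRight key), Nat.card_eq_fintype_card,
    Fintype.card_coe, Finset.card_image_of_injective, Finset.card_range]
  intro i j hij
  simp only [Prod.mk.injEq] at hij
  omega
end

section
/- Let p ≥ 5 be a prime of the form p = 12l + 5 for a nonnegative integer l. Then N(p, (−1, 1, 2)) = l + 1. -/
/-- For `p = 12 * l + 5`, the triples counted by `Nweight p (-1) 1 2` are exactly
`(3 * l + k + 1, 3 * (l - k), 2 * k)` with `k ≤ l`. -/
theorem nweight_triple_iff (l : ℕ) (n : ℕ × ℕ × ℕ) :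
    (n.1 + n.2.1 + n.2.2 = (12 * l + 5 - 3) / 2 ∧
      ((12 * l + 5 : ℕ) : ℤ) ∣ (-1) * n.1 + 1 * n.2.1 + 2 * n.2.2 + ((-1) + 1 + 2) / 2) ↔
    ∃ k ≤ l, n = (3 * l + k + 1, 3 * (l - k), 2 * k) := by
  obtain ⟨a, b, c⟩ := n
  simp only [Prod.mk.injEq]
  constructor
  · rintro ⟨hsum, hdvd⟩
    have hzero := Int.eq_zero_of_abs_lt_dvd hdvd (by rw [abs_lt]; constructor <;> omega)
    exact ⟨c / 2, by omega, by omega, by omega, by omega⟩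
  · rintro ⟨k, hk, rfl, rfl, rfl⟩
    refine ⟨by omega, ?_⟩
    have hzero : (-1 : ℤ) * (3 * l + k + 1 : ℕ) + 1 * (3 * (l - k) : ℕ) + 2 * (2 * k : ℕ)
        + ((-1) + 1 + 2) / 2 = 0 := by omega
    rw [hzero]
    exact dvd_zero _

/-- If `p ≥ 5` is a prime of the form `p = 12l + 5` with `l` a nonnegative integer,
then `N(p, (-1, 1, 2)) = l + 1`. -/
theorem stmt_7 (p l : ℕ) (hp : p.Prime) (hp5 : 5 ≤ p) (hpl : p = 12 * l + 5) :
    Nweight p (-1) 1 2 = l + 1 := by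
  subst hpl
  let f : Fin (l + 1) → {n : ℕ × ℕ × ℕ //
      n.1 + n.2.1 + n.2.2 = (12 * l + 5 - 3) / 2 ∧
      ((12 * l + 5 : ℕ) : ℤ) ∣ (-1) * n.1 + 1 * n.2.1 + 2 * n.2.2 + ((-1) + 1 + 2) / 2} :=
    fun k => ⟨(3 * l + k + 1, 3 * (l - k), 2 * k),
      (nweight_triple_iff l _).2 ⟨k, Nat.lt_succ_iff.1 k.2, rfl⟩⟩
  have hf : Function.Bijective f := by
    constructor
    · intro i j hij
      have h := congrArg (fun x => x.1.1) hij
      simp only [f] at h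
      exact Fin.ext (by omega)
    · rintro ⟨n, hn⟩
      obtain ⟨k, hk, rfl⟩ := (nweight_triple_iff l n).1 hn
      exact ⟨⟨k, Nat.lt_succ_iff.2 hk⟩, rfl⟩
  exact (Nat.card_eq_of_bijective f hf).symm.trans (Nat.card_fin _)
end

section
/- Let p ≥ 5 be a prime, and write p = 12l + q with l an integer and q ∈ {−5, −1, 1, 5}. Then N(p, (−1, 0, 1)) − N(p, (−1, 1, 2)) = 2l. -/
/-- A subtype enumerated injectively by the natural numbers below `k` has cardinality `k`. -/
theorem natCard_subtype_eq_of_enumeration {α : Type*} {P : α → Prop} (k : ℕ) (f : ℕ → α)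
    (hf : Function.Injective f) (h : ∀ x, P x ↔ ∃ t < k, f t = x) :
    Nat.card {x // P x} = k := by
  have hset : {x | P x} = f '' Set.Iio k := by
    ext x
    simpa using h x
  calc Nat.card {x // P x} = Set.ncard {x | P x} := rfl
    _ = k := by rw [hset, Set.ncard_image_of_injective _ hf, Set.ncard_Iio_nat]

/-- The congruence forces `n₀ = n₂`. -/
theorem Nweight_neg_one_zero_one (p : ℕ) (hp : 5 ≤ p) :
    Nweight p (-1) 0 1 = (p - 3) / 2 / 2 + 1 := by
  refine natCard_subtype_eq_of_enumeration _ (fun t => (t, (p - 3) / 2 - 2 * t, t))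
    (fun a b hab => congrArg Prod.fst hab) ?_
  rintro ⟨a, b, c⟩
  simp only [Prod.mk.injEq]
  constructor
  · rintro ⟨hsum, hdvd⟩
    have hzero := Int.eq_zero_of_abs_lt_dvd hdvd (by rw [abs_lt]; omega)
    exact ⟨a, by omega, by omega⟩
  · rintro ⟨t, ht, rfl, rfl, rfl⟩
    exact ⟨by omega, by simp⟩

/-- The congruence forces `n₀ = n₁ + 2 n₂ + 1`, hence `2 n₁ + 3 n₂ = (p - 5) / 2`. -/
theorem Nweight_neg_one_one_two (p : ℕ) (hp : 5 ≤ p) (hodd : p % 2 = 1) :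
    Nweight p (-1) 1 2 = ((p - 5) / 2 + 6 - 3 * ((p - 5) / 2 % 2)) / 6 := by
  obtain ⟨n, rfl⟩ : ∃ n, p = 2 * n + 5 := ⟨(p - 5) / 2, by omega⟩
  have hn : (2 * n + 5 - 5) / 2 = n := by omega
  rw [hn]
  refine natCard_subtype_eq_of_enumeration _
    (fun t => ((n - 6 * t - 3 * (n % 2)) / 2 + 2 * (2 * t + n % 2) + 1,
      (n - 6 * t - 3 * (n % 2)) / 2, 2 * t + n % 2)) ?_ ?_
  · intro a b hab
    simp only [Prod.mk.injEq] at hab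
    omega
  rintro ⟨a, b, c⟩
  simp only [Prod.mk.injEq]
  constructor
  · rintro ⟨hsum, hdvd⟩
    have hzero := Int.eq_zero_of_abs_lt_dvd hdvd (by rw [abs_lt]; omega)
    have hlin : n = 2 * b + 3 * c := by omega
    have hpar : n % 2 = c % 2 := by omega
    exact ⟨c / 2, by omega, by omega, by omega, by omega⟩
  · rintro ⟨t, ht, rfl, rfl, rfl⟩
    refine ⟨by omega, ?_⟩
    refine ⟨0, ?_⟩
    generalize (n - 6 * t - 3 * (n % 2)) / 2 = k
    generalize 2 * t + n % 2 = j
    omega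

/-- If `p ≥ 5` is a prime written as `p = 12l + q` with `l` an integer and
`q ∈ {-5, -1, 1, 5}`, then `N(p, (-1, 0, 1)) - N(p, (-1, 1, 2)) = 2l`. -/
theorem stmt_8 (p : ℕ) (hp : p.Prime) (hp5 : 5 ≤ p) (l q : ℤ)
    (hq : q ∈ ({-5, -1, 1, 5} : Set ℤ)) (hpl : (p : ℤ) = 12 * l + q) :
    (Nweight p (-1) 0 1 : ℤ) - (Nweight p (-1) 1 2 : ℤ) = 2 * l := by
  have hodd : p % 2 = 1 := by
    rcases hq with rfl | rfl | rfl | rfl <;> omega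
  rw [Nweight_neg_one_zero_one p hp5, Nweight_neg_one_one_two p hp5 hodd]
  rcases hq with rfl | rfl | rfl | rfl <;> omega
end
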